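/- (Distance of a channel from a unitary, upper bound.) Let K be a finite index type, let (E_k)_{k ∈ K} be d×d complex matrices with Σ_k E_k† · E_k = 1, and let (λ_k)_{k ∈ K} be nonnegative reals with tr(E_k† · E_l) = d·λ_k if k = l and 0 otherwise, and Σ_k λ_k = 1. Suppose k₀ ∈ K satisfies λ_{k₀} ≥ λ_k for all k. Set P = Σ_k λ_k². Then there exists a unitary d×d matrix U such that ‖Σ_k E_k ⊗ conj(E_k) - U ⊗ conj(U)‖₂ ≤ d·√(P - P²) + d·√(1 - P²), and in particular this is at most 2d·√(1 - P²). -/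

import Mathlib

open scoped Matrix ComplexOrder

open scoped Kronecker

/-- The operator norm of a complex matrix induced by the ℓ² (Euclidean) vector norm,
i.e. the largest singular value. -/
noncomputable def opNorm {m n : Type*} [Fintype m] [Fintype n] [DecidableEq n]
    (A : Matrix m n ℂ) : ℝ :=
  ‖LinearMap.toContinuousLinearMap (Matrix.toEuclideanLin A)‖

/-- The Frobenius (Hilbert–Schmidt) norm of a complex matrix: `√(tr(AᴴA))`. -/
noncomputable def frobNorm {m n : Type*} [Fintype m] [Fintype n] (A : Matrix m n ℂ) : ℝ :=
  Real.sqrt (Matrix.trace (Aᴴ * A)).re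

theorem frobNorm_add_le {m n : Type*} [Fintype m] [Fintype n] (A B : Matrix m n ℂ) :
    frobNorm (A + B) ≤ frobNorm A + frobNorm B := by
  let : NormedAddCommGroup (Matrix m n ℂ) := Matrix.frobeniusNormedAddCommGroup
  have h : ∀ C : Matrix m n ℂ, frobNorm C = ‖C‖ := by
    intro C
    rw [Matrix.frobenius_norm_def, ← Real.sqrt_eq_rpow, frobNorm, Finset.sum_comm]
    congr 1
    simp [Matrix.trace, Matrix.mul_apply, ← Complex.normSq_eq_conj_mul_self,
      Complex.normSq_eq_norm_sq]
    norm_cast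
  simpa only [h] using norm_add_le A B

theorem trace_conjTranspose_mul_kronecker_conj {n : Type*} [Fintype n] (A B : Matrix n n ℂ) :
    Matrix.trace ((A ⊗ₖ A.map (starRingEnd ℂ))ᴴ * (B ⊗ₖ B.map (starRingEnd ℂ)))
      = (Complex.normSq (Matrix.trace (Aᴴ * B)) : ℂ) := by
  have h : (A.map (starRingEnd ℂ))ᴴ * B.map (starRingEnd ℂ) = (Aᴴ * B).map (starRingEnd ℂ) := by
    ext i j
    simp [Matrix.mul_apply]
  rw [Matrix.conjTranspose_kronecker, ← Matrix.mul_kronecker_mul, Matrix.trace_kronecker, h,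
    ← Complex.mul_conj, ← AddMonoidHom.map_trace]

/-- A contraction `A` has overlap at least `tr(AᴴA)` with some unitary matrix, namely the unitary
factor of a polar decomposition of `A`. -/
theorem exists_unitary_le_re_trace {n : Type*} [Fintype n] [DecidableEq n] (A : Matrix n n ℂ)
    (hA : (1 - Aᴴ * A).PosSemidef) :
    ∃ U ∈ Matrix.unitaryGroup n ℂ, (Matrix.trace (Aᴴ * A)).re ≤ (Matrix.trace (Uᴴ * A)).re := by
  have hH : (Aᴴ * A).IsHermitian := Matrix.isHermitian_conjTranspose_mul_self A
  set V : Matrix n n ℂ := (hH.eigenvectorUnitary : Matrix n n ℂ)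
  have hVV : Vᴴ * V = 1 := Matrix.mem_unitaryGroup_iff'.mp hH.eigenvectorUnitary.2
  have hVV' : V * Vᴴ = 1 := Matrix.mem_unitaryGroup_iff.mp hH.eigenvectorUnitary.2
  set B := A * V with hB
  have hBB : Bᴴ * B = Matrix.diagonal (fun i => (hH.eigenvalues i : ℂ)) := by
    have h := hH.conjStarAlgAut_star_eigenvectorUnitary
    rw [Unitary.conjStarAlgAut_star_apply] at h
    rw [hB, Matrix.conjTranspose_mul]
    simpa [Matrix.mul_assoc, Matrix.star_eq_conjTranspose, Function.comp_def] using h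
  let b : n → EuclideanSpace ℂ n := fun i => WithLp.toLp 2 (fun j => B j i)
  have hb : ∀ i j, inner ℂ (b i) (b j) = (Bᴴ * B) i j := by
    intro i j
    simp [b, PiLp.inner_apply, Matrix.mul_apply, mul_comm]
  have hb_norm : ∀ i, ‖b i‖ ≤ 1 := by
    intro i
    have h1 := (hA.conjTranspose_mul_mul_same V).diag_nonneg (i := i)
    have h2 : Vᴴ * (1 - Aᴴ * A) * V = 1 - Bᴴ * B := by
      rw [hB, Matrix.conjTranspose_mul, Matrix.mul_sub, Matrix.sub_mul, Matrix.mul_one, hVV]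
      simp only [Matrix.mul_assoc]
    rw [h2, Matrix.sub_apply, Matrix.one_apply_eq, ← hb, inner_self_eq_norm_sq_to_K] at h1
    have h3 : (0 : ℝ) ≤ 1 - ‖b i‖ ^ 2 := by
      have := (Complex.le_def.mp h1).1
      norm_cast at this
    nlinarith [norm_nonneg (b i)]
  have horth : Orthonormal ℂ
      ({i | b i ≠ 0}.domRestrict (fun i => ((‖b i‖⁻¹ : ℝ) : ℂ) • b i)) := by
    refine ⟨fun i => ?_, fun i j hij => ?_⟩
    · have : ‖b i‖ ≠ 0 := norm_ne_zero_iff.mpr i.2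
      rw [Set.domRestrict_apply]
      simp [norm_smul, this]
    · have : (i : n) ≠ j := fun h => hij (Subtype.ext h)
      beta_reduce
      rw [Set.domRestrict_apply, Set.domRestrict_apply]
      simp [inner_smul_left, inner_smul_right, hb, hBB, this]
  obtain ⟨w, hw⟩ := horth.exists_orthonormalBasis_extension_of_card_eq (by simp)
  have hwb : ∀ i, inner ℂ (w i) (b i) = (‖b i‖ : ℂ) := by
    intro i
    by_cases hi : b i = 0
    · simp [hi]
    · have : (‖b i‖ : ℂ) ≠ 0 := by simpa using hi
      rw [hw i hi, inner_smul_left, inner_self_eq_norm_sq_to_K]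
      simp
      field_simp
  let W : Matrix n n ℂ := Matrix.of fun i j => w j i
  have hW : Wᴴ * W = 1 := by
    ext i j
    have h := orthonormal_iff_ite.mp w.orthonormal i j
    rw [Matrix.one_apply, ← h]
    simp [W, PiLp.inner_apply, Matrix.mul_apply, mul_comm]
  refine ⟨W * Vᴴ, Matrix.mem_unitaryGroup_iff'.mpr ?_, ?_⟩
  · rw [Matrix.star_eq_conjTranspose, Matrix.conjTranspose_mul, Matrix.conjTranspose_conjTranspose,
      Matrix.mul_assoc, ← Matrix.mul_assoc Wᴴ, hW, Matrix.one_mul, hVV']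
  · have hU : Matrix.trace ((W * Vᴴ)ᴴ * A) = ∑ i, (‖b i‖ : ℂ) := by
      rw [Matrix.conjTranspose_mul, Matrix.conjTranspose_conjTranspose, Matrix.mul_assoc,
        Matrix.trace_mul_comm, Matrix.mul_assoc]
      refine Finset.sum_congr rfl fun i _ => ?_
      rw [← hwb]
      simp [W, b, B, PiLp.inner_apply, Matrix.mul_apply, mul_comm]
    have hT : Matrix.trace (Aᴴ * A) = ∑ i, (‖b i‖ : ℂ) ^ 2 := by
      have : Matrix.trace (Aᴴ * A) = Matrix.trace (Bᴴ * B) := by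
        rw [hB, Matrix.conjTranspose_mul, Matrix.mul_assoc, Matrix.trace_mul_comm Vᴴ,
          Matrix.mul_assoc, Matrix.mul_assoc, hVV', Matrix.mul_one]
      rw [this]
      refine Finset.sum_congr rfl fun i _ => ?_
      rw [Matrix.diag_apply, ← hb, inner_self_eq_norm_sq_to_K]
      rfl
    rw [hU, hT]
    norm_cast
    exact Finset.sum_le_sum fun i _ => by nlinarith [norm_nonneg (b i), hb_norm i]

theorem frobNorm_kronecker_conj_sub_le {d : ℕ} (A U : Matrix (Fin d) (Fin d) ℂ) (p : ℝ)
    (hp : 0 ≤ p) (hA : Matrix.trace (Aᴴ * A) = (d : ℂ) * (p : ℂ))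
    (hU : U ∈ Matrix.unitaryGroup (Fin d) ℂ)
    (hUA : (Matrix.trace (Aᴴ * A)).re ≤ (Matrix.trace (Uᴴ * A)).re) :
    frobNorm (A ⊗ₖ A.map (starRingEnd ℂ) - U ⊗ₖ U.map (starRingEnd ℂ))
      ≤ (d : ℝ) * Real.sqrt (1 - p ^ 2) := by
  have hUU : Uᴴ * U = 1 := Matrix.mem_unitaryGroup_iff'.mp hU
  have hswap : Matrix.trace (Aᴴ * U) = star (Matrix.trace (Uᴴ * A)) := by
    rw [← Matrix.trace_conjTranspose, Matrix.conjTranspose_mul, Matrix.conjTranspose_conjTranspose]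
  have hle : (d : ℝ) * p ≤ (Matrix.trace (Uᴴ * A)).re := by
    refine le_of_eq_of_le ?_ hUA
    rw [hA]
    simp
  have hsq : ((d : ℝ) * p) ^ 2 ≤ Complex.normSq (Matrix.trace (Uᴴ * A)) := by
    rw [Complex.normSq_apply]
    nlinarith [mul_nonneg (Nat.cast_nonneg (α := ℝ) d) hp,
      mul_self_nonneg (Matrix.trace (Uᴴ * A)).im]
  rw [frobNorm]
  refine (Real.sqrt_le_sqrt (y := (d : ℝ) ^ 2 * (1 - p ^ 2)) ?_).trans_eq ?_
  · simp only [Matrix.conjTranspose_sub, Matrix.sub_mul, Matrix.mul_sub, Matrix.trace_sub,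
      trace_conjTranspose_mul_kronecker_conj, hUU, hswap, hA, Matrix.trace_one, Complex.sub_re,
      Complex.ofReal_re, Complex.star_def, Complex.normSq_conj, Fintype.card_fin,
      Complex.normSq_natCast, Complex.normSq_mul, Complex.normSq_ofReal]
    nlinarith
  · rw [Real.sqrt_mul (sq_nonneg _), Real.sqrt_sq (Nat.cast_nonneg d)]

theorem frobNorm_sum_kronecker_conj {d : ℕ} {K : Type*} [DecidableEq K]
    (E : K → Matrix (Fin d) (Fin d) ℂ) (lam : K → ℝ)
    (horth : ∀ k l, Matrix.trace ((E k)ᴴ * E l)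
      = if k = l then (d : ℂ) * (lam k : ℂ) else 0) (s : Finset K) :
    frobNorm (∑ k ∈ s, E k ⊗ₖ (E k).map (starRingEnd ℂ))
      = (d : ℝ) * Real.sqrt (∑ k ∈ s, lam k ^ 2) := by
  have h : (Matrix.trace ((∑ k ∈ s, E k ⊗ₖ (E k).map (starRingEnd ℂ))ᴴ
      * ∑ k ∈ s, E k ⊗ₖ (E k).map (starRingEnd ℂ))).re = (d : ℝ) ^ 2 * ∑ k ∈ s, lam k ^ 2 := by
    simp only [Matrix.conjTranspose_sum, Matrix.sum_mul, Matrix.mul_sum, Matrix.trace_sum,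
      trace_conjTranspose_mul_kronecker_conj, horth, Complex.re_sum, Complex.ofReal_re]
    rw [Finset.mul_sum]
    refine Finset.sum_congr rfl fun k hk => ?_
    rw [Finset.sum_eq_single_of_mem k hk fun l _ hl => by simp [hl]]
    simp only [if_true, Complex.normSq_mul, Complex.normSq_natCast, Complex.normSq_ofReal]
    ring
  rw [frobNorm, h, Real.sqrt_mul (sq_nonneg _), Real.sqrt_sq (Nat.cast_nonneg d)]

theorem stmt_16 {d : ℕ} {K : Type*} [Fintype K] [DecidableEq K]
    (E : K → Matrix (Fin d) (Fin d) ℂ) (lam : K → ℝ) (hlam : ∀ k, 0 ≤ lam k)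
    (hKraus : ∑ k, (E k)ᴴ * E k = 1)
    (horth : ∀ k l, Matrix.trace ((E k)ᴴ * E l)
      = if k = l then (d : ℂ) * (lam k : ℂ) else 0)
    (hsum : ∑ k, lam k = 1)
    (k₀ : K) (hk₀ : ∀ k, lam k ≤ lam k₀) :
    ∃ U : Matrix (Fin d) (Fin d) ℂ, U ∈ Matrix.unitaryGroup (Fin d) ℂ ∧
      frobNorm (∑ k, E k ⊗ₖ (E k).map (starRingEnd ℂ) - U ⊗ₖ U.map (starRingEnd ℂ))
        ≤ (d : ℝ) * Real.sqrt ((∑ k, lam k ^ 2) - (∑ k, lam k ^ 2) ^ 2)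
          + (d : ℝ) * Real.sqrt (1 - (∑ k, lam k ^ 2) ^ 2) ∧
      (d : ℝ) * Real.sqrt ((∑ k, lam k ^ 2) - (∑ k, lam k ^ 2) ^ 2)
          + (d : ℝ) * Real.sqrt (1 - (∑ k, lam k ^ 2) ^ 2)
        ≤ 2 * (d : ℝ) * Real.sqrt (1 - (∑ k, lam k ^ 2) ^ 2) := by
  have hP0 : 0 ≤ ∑ k, lam k ^ 2 := Finset.sum_nonneg fun k _ => sq_nonneg _
  have hPp : ∑ k, lam k ^ 2 ≤ lam k₀ := by
    calc ∑ k, lam k ^ 2 ≤ ∑ k, lam k₀ * lam k :=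
          Finset.sum_le_sum fun k _ => by nlinarith [hlam k, hk₀ k]
      _ = lam k₀ := by rw [← Finset.mul_sum, hsum, mul_one]
  have hp1 : lam k₀ ≤ 1 :=
    hsum ▸ Finset.single_le_sum (fun k _ => hlam k) (Finset.mem_univ k₀)
  have hcontr : (1 - (E k₀)ᴴ * E k₀).PosSemidef := by
    rw [← hKraus, ← Finset.add_sum_erase _ _ (Finset.mem_univ k₀), add_sub_cancel_left]
    exact Matrix.posSemidef_sum _ fun k _ => Matrix.posSemidef_conjTranspose_mul_self (E k)
  obtain ⟨U, hU, hUA⟩ := exists_unitary_le_re_trace (E k₀) hcontr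
  have hrest := frobNorm_sum_kronecker_conj E lam horth (Finset.univ.erase k₀)
  have hmain := frobNorm_kronecker_conj_sub_le (E k₀) U (lam k₀) (hlam k₀)
    (by simpa using horth k₀ k₀) hU hUA
  have hlamsum := Finset.add_sum_erase Finset.univ (fun k => lam k ^ 2) (Finset.mem_univ k₀)
  have hsq : (∑ k, lam k ^ 2) ^ 2 ≤ lam k₀ ^ 2 := pow_le_pow_left₀ hP0 hPp 2
  refine ⟨U, hU, ?_, ?_⟩
  · rw [← Finset.add_sum_erase _ (fun k => E k ⊗ₖ (E k).map (starRingEnd ℂ))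
      (Finset.mem_univ k₀), add_comm, add_sub_assoc]
    refine (frobNorm_add_le _ _).trans (add_le_add ?_ ?_)
    · rw [hrest]
      gcongr
      linarith
    · refine hmain.trans ?_
      gcongr
  · have : Real.sqrt ((∑ k, lam k ^ 2) - (∑ k, lam k ^ 2) ^ 2)
        ≤ Real.sqrt (1 - (∑ k, lam k ^ 2) ^ 2) := by
      gcongr
      exact hPp.trans hp1
    nlinarith [mul_le_mul_of_nonneg_left this (Nat.cast_nonneg (α := ℝ) d)]
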